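/- arXiv:1803.04529 — 3 statements merged into one kernel-verified Lean document; each statement's English description precedes it below -/
import Mathlib

section
/- Fix r ∈ ℕ_+ and let A(r,k) = Σ_{i=0}^r (-1)^i·C(r,i)/(k-i)! for 0 ≤ k ≤ r, where by convention 1/(k-i)! = 0 when i > k. Then for every ε > 0, the quantity D_r(n)/n! − (1/e)·Σ_{k=0}^{r} A(r,k)·C(n+r-k, n) is O(ε^n) as n → ∞; that is, there is a constant M such that |D_r(n)/n! − (1/e)·Σ_{k=0}^{r} A(r,k)·C(n+r-k, n)| ≤ M·ε^n for all n. -/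
/-- The `r`-derangement number `D_r(n)`: the number of fixed-point-free permutations
of `n + r` elements such that the first `r` (distinguished) elements lie in pairwise
distinct cycles of the cycle decomposition. -/
noncomputable def rDerangement (r n : ℕ) : ℕ :=
  Nat.card {σ : Equiv.Perm (Fin (n + r)) //
    (∀ x, σ x ≠ x) ∧
    ∀ i j : Fin (n + r), (i : ℕ) < r → (j : ℕ) < r → i ≠ j → ¬ σ.SameCycle i j}

/-- The elements satisfying `p` lie in pairwise distinct cycles of `σ`. -/
def SepCycles {α : Type} (p : α → Prop) (σ : Equiv.Perm α) : Prop :=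
  ∀ i j : α, p i → p j → i ≠ j → ¬ σ.SameCycle i j

theorem sameCycle_transfer {α β : Type} [Finite β] (σ : Equiv.Perm β) (τ : Equiv.Perm α)
    (f : β → α) (h : ∀ z, τ.SameCycle (f z) (f (σ z))) {z w : β} (hzw : σ.SameCycle z w) :
    τ.SameCycle (f z) (f w) := by
  obtain ⟨n, rfl⟩ := hzw.exists_nat_pow_eq
  clear hzw
  induction n with
  | zero => exact Equiv.Perm.SameCycle.refl _ _
  | succ n ih =>
    rw [pow_succ', Equiv.Perm.mul_apply]
    exact ih.trans (h _)

theorem sepCycles_conj {α β : Type} (e : α ≃ β) (p : α → Prop) (q : β → Prop)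
    [Finite α] (h : ∀ x, p x ↔ q (e x)) (σ : Equiv.Perm α) :
    SepCycles p σ ↔ SepCycles q (e.permCongr σ) := by
  have : Finite β := Finite.of_equiv α e
  have key : ∀ i j, (e.permCongr σ).SameCycle (e i) (e j) ↔ σ.SameCycle i j := by
    intro i j
    constructor
    · intro H
      have := sameCycle_transfer (e.permCongr σ) σ e.symm (fun z => by
        simp [Equiv.permCongr_apply, Equiv.Perm.SameCycle.refl]) H
      simpa using this
    · intro H
      refine sameCycle_transfer σ (e.permCongr σ) e (fun z => ?_) H
      have : e (σ z) = (e.permCongr σ) (e z) := by simp [Equiv.permCongr_apply]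
      rw [this, Equiv.Perm.sameCycle_apply_right]
  constructor
  · intro H i j hi hj hij hs
    refine H (e.symm i) (e.symm j) ((h _).2 (by simpa using hi)) ((h _).2 (by simpa using hj))
      (by simpa using hij) ((key _ _).1 (by simpa using hs))
  · intro H i j hi hj hij hs
    exact H (e i) (e j) ((h _).1 hi) ((h _).1 hj) (by simpa using hij) ((key _ _).2 hs)

/-- The number of permutations with the elements of `p` in distinct cycles. -/
noncomputable def sepCount (α : Type) (p : α → Prop) : ℕ :=
  Nat.card {σ : Equiv.Perm α // SepCycles p σ}

theorem sepCount_congr {α β : Type} [Finite α] (e : α ≃ β) (p : α → Prop) (q : β → Prop)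
    (h : ∀ x, p x ↔ q (e x)) : sepCount α p = sepCount β q :=
  Nat.card_congr (e.permCongr.subtypeEquiv (fun σ => sepCycles_conj e p q h σ))

theorem sameCycle_option {α : Type} [DecidableEq α] [Finite α] (i : Option α) (τ : Equiv.Perm α)
    (x y : α) : (Equiv.swap none i * τ.optionCongr).SameCycle (some x) (some y) ↔
      τ.SameCycle x y := by
  have hσ : ∀ x, (Equiv.swap none i * τ.optionCongr) (some x) =
      if i = some (τ x) then none else some (τ x) := by
    intro x
    rw [Equiv.Perm.mul_apply, Equiv.optionCongr_apply, Option.map_some, Equiv.swap_apply_def]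
    by_cases h : i = some (τ x)
    · simp [h]
    · have h' : ¬ some (τ x) = i := fun h2 => h h2.symm
      simp [h, h']
  have hn : (Equiv.swap none i * τ.optionCongr) none = i := by
    simp
  generalize hS : Equiv.swap none i * τ.optionCongr = σ at *
  constructor
  · intro H
    have := sameCycle_transfer σ τ (fun z => z.getD (i.getD x)) (fun z => ?_) H
    · simpa using this
    · cases z with
      | none =>
        rw [hn]
        cases i <;> simp [Equiv.Perm.SameCycle.refl]
      | some z =>
        rw [hσ]
        split_ifs with h
        · subst h; simp [Equiv.Perm.SameCycle.refl]
        · simp [Equiv.Perm.SameCycle.refl]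
  · intro H
    refine sameCycle_transfer τ σ some (fun z => ?_) H
    by_cases h : i = some (τ z)
    · have h1 := hσ z
      rw [if_pos h] at h1
      have : some (τ z) = σ (σ (some z)) := by rw [h1, hn, h]
      rw [this]; simp [Equiv.Perm.SameCycle.refl]
    · have h1 := hσ z
      rw [if_neg h] at h1
      rw [← h1]; simp [Equiv.Perm.SameCycle.refl]

theorem sepCount_option {α : Type} [Fintype α] (p : α → Prop) :
    sepCount (Option α) (fun o => ∃ a, o = some a ∧ p a) =
      (Nat.card α + 1) * sepCount α p := by
  classical
  have e1 : {σ : Equiv.Perm (Option α) // SepCycles (fun o => ∃ a, o = some a ∧ p a) σ} ≃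
      {x : Option α × Equiv.Perm α // SepCycles p x.2} := by
    refine (Equiv.Perm.decomposeOption.symm.subtypeEquiv ?_).symm
    rintro ⟨i, τ⟩
    change _ ↔ SepCycles _ (Equiv.swap none i * τ.optionCongr)
    constructor
    · rintro H _ _ ⟨a, rfl, ha⟩ ⟨b, rfl, hb⟩ hab hs
      exact H a b ha hb (by simpa using hab) ((sameCycle_option i τ a b).1 hs)
    · intro H a b ha hb hab hs
      exact H (some a) (some b) ⟨a, rfl, ha⟩ ⟨b, rfl, hb⟩ (by simpa using hab)
        ((sameCycle_option i τ a b).2 hs)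
  have e2 : {x : Option α × Equiv.Perm α // SepCycles p x.2} ≃
      Option α × {σ : Equiv.Perm α // SepCycles p σ} :=
    { toFun := fun x => (x.1.1, ⟨x.1.2, x.2⟩)
      invFun := fun x => ⟨(x.1, x.2.1), x.2.2⟩
      left_inv := fun _ => rfl
      right_inv := fun _ => rfl }
  unfold sepCount
  rw [Nat.card_congr (e1.trans e2), Nat.card_prod]
  simp

theorem sepCount_all {α : Type} [Finite α] (p : α → Prop) (hp : ∀ x, p x) :
    sepCount α p = 1 := by
  unfold sepCount
  have : ∀ σ : Equiv.Perm α, SepCycles p σ ↔ σ = 1 := by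
    intro σ
    constructor
    · intro H
      ext x
      by_contra hx
      exact H x (σ x) (hp _) (hp _) (Ne.symm hx) (by simp [Equiv.Perm.SameCycle.refl])
    · rintro rfl i j _ _ hij hs
      exact hij (Equiv.Perm.sameCycle_one.1 hs)
  simp [this]

theorem sepCount_mul (n : ℕ) : ∀ (α : Type) [Fintype α] (p : α → Prop),
    Nat.card {x // ¬ p x} = n →
    sepCount α p * (Nat.card {x // p x}).factorial = (Nat.card α).factorial := by
  classical
  induction n with
  | zero =>
    intro α _ p h
    have hp : ∀ x, p x := by
      intro x
      by_contra hx
      rw [Nat.card_eq_zero] at h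
      rcases h with h | h
      · exact h.false ⟨x, hx⟩
      · exact h.not_finite inferInstance
    rw [sepCount_all p hp, one_mul, Nat.card_congr (Equiv.subtypeUnivEquiv hp)]
  | succ n ih =>
    intro α _ p h
    obtain ⟨⟨v, hv⟩⟩ : Nonempty {x // ¬ p x} := by
      rw [← Finite.card_pos_iff]; omega
    let e := Equiv.optionSubtypeNe v
    have hc : sepCount α p = (Nat.card {x // x ≠ v} + 1) *
        sepCount {x // x ≠ v} (fun x => p x) := by
      rw [← sepCount_option]
      refine (sepCount_congr e _ _ ?_).symm
      intro o
      cases o with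
      | none => simp [e, hv]
      | some a => simp [e]
    have hcard : Nat.card α = Nat.card {x // x ≠ v} + 1 := by
      rw [← Nat.card_congr e]; simp
    have h1 : Nat.card {x : {x // x ≠ v} // p x} = Nat.card {x // p x} := by
      refine Nat.card_congr (Equiv.subtypeSubtypeEquivSubtype ?_)
      rintro x hx rfl
      exact hv hx
    have h3 : Nat.card {x // p x} + Nat.card {x // ¬ p x} = Nat.card α := by
      rw [← Nat.card_sum, Nat.card_congr (Equiv.sumCompl p)]
    have h4 : Nat.card {x : {x // x ≠ v} // p x} + Nat.card {x : {x // x ≠ v} // ¬ p x} =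
        Nat.card {x // x ≠ v} := by
      rw [← Nat.card_sum, Nat.card_congr (Equiv.sumCompl _)]
    have h2 := ih {x // x ≠ v} (fun x => p x) (by omega)
    rw [h1] at h2
    rw [hc, hcard, Nat.factorial_succ, ← h2, mul_assoc]

theorem card_fix_sep {α : Type} [Fintype α] [DecidableEq α] (p : α → Prop) (S : Finset α) :
    Nat.card {σ : Equiv.Perm α // SepCycles p σ ∧ ∀ x ∈ S, σ x = x} =
      sepCount {x // x ∉ S} (fun x => p x) := by
  classical
  have e1 := (Equiv.subtypeSubtypeEquivSubtypeInter
    (fun σ : Equiv.Perm α => ∀ x, ¬ (x ∉ S) → σ x = x) (fun σ => SepCycles p σ))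
  have e2 : {τ : Equiv.Perm {x // x ∉ S} // SepCycles (fun x : {x // x ∉ S} => p x) τ} ≃
      {σ : {σ : Equiv.Perm α // ∀ x, ¬ (x ∉ S) → σ x = x} // SepCycles p σ.1} := by
    refine (Equiv.Perm.subtypeEquivSubtypePerm (fun x => x ∉ S)).subtypeEquiv ?_
    intro τ
    change _ ↔ SepCycles p (Equiv.Perm.ofSubtype τ)
    have key : ∀ i j : {x // x ∉ S}, (Equiv.Perm.ofSubtype τ).SameCycle (i : α) (j : α) ↔ τ.SameCycle i j := by
      intro i j
      constructor
      · intro H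
        have := sameCycle_transfer (Equiv.Perm.ofSubtype τ) τ
          (fun x => if h : x ∉ S then ⟨x, h⟩ else i) (fun z => ?_) H
        · simpa [i.2, j.2] using this
        · by_cases hz : z ∉ S
          · rw [Equiv.Perm.ofSubtype_apply_of_mem τ hz]
            simp [hz, (τ ⟨z, hz⟩).2, Equiv.Perm.SameCycle.refl]
          · rw [Equiv.Perm.ofSubtype_apply_of_not_mem τ hz]
      · intro H
        refine sameCycle_transfer τ (Equiv.Perm.ofSubtype τ) Subtype.val (fun z => ?_) H
        rw [← Equiv.Perm.ofSubtype_apply_coe, Equiv.Perm.sameCycle_apply_right]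
    constructor
    · intro H i j hi hj hij hs
      by_cases h1 : i ∉ S
      · by_cases h2 : j ∉ S
        · exact H ⟨i, h1⟩ ⟨j, h2⟩ hi hj (by simpa using hij) ((key ⟨i, h1⟩ ⟨j, h2⟩).1 hs)
        · exact hij (hs.eq_of_right (Equiv.Perm.ofSubtype_apply_of_not_mem τ h2))
      · exact hij (hs.eq_of_left (Equiv.Perm.ofSubtype_apply_of_not_mem τ h1))
    · intro H i j hi hj hij hs
      exact H i j hi hj (fun h => hij (Subtype.ext h)) ((key i j).2 hs)
  unfold sepCount
  rw [Nat.card_congr (e2.trans e1)]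
  refine Nat.card_congr (Equiv.subtypeEquivRight fun σ => ?_)
  simp only [not_not]
  exact and_comm

theorem derange_incl_excl {α : Type} [Fintype α] [DecidableEq α] (p : α → Prop) :
    (Nat.card {σ : Equiv.Perm α // (∀ x, σ x ≠ x) ∧ SepCycles p σ} : ℤ) =
      ∑ S : Finset α, (-1) ^ S.card * (sepCount {x // x ∉ S} (fun x => p x) : ℤ) := by
  classical
  simp_rw [← card_fix_sep p, Nat.card_eq_fintype_card, Fintype.card_subtype,
    Finset.card_filter]
  push_cast
  simp_rw [Finset.mul_sum]
  rw [Finset.sum_comm]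
  refine Finset.sum_congr rfl fun σ _ => ?_
  by_cases hs : SepCycles p σ
  · have := Finset.sum_powerset_neg_one_pow_card (x := Finset.univ.filter fun x => σ x = x)
    simp only [hs, and_true, true_and]
    have h2 : (Finset.univ.filter fun x => σ x = x).powerset =
      Finset.univ.filter (fun S : Finset α => ∀ x ∈ S, σ x = x) := by
      ext S; simp [Finset.subset_iff]
    rw [h2, Finset.sum_filter] at this
    simp only [mul_ite, mul_one, mul_zero]
    rw [this]
    simp [Finset.filter_eq_empty_iff]
  · simp [hs]

theorem rDerangement_eq (r n : ℕ) : (rDerangement r n : ℤ) =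
    ∑ s ∈ Finset.range (r + 1), ∑ t ∈ Finset.range (n + 1),
      (-1) ^ (s + t) * (r.choose s : ℤ) * (n.choose t) *
        (((n - t + (r - s)).choose (r - s) * (n - t).factorial : ℕ) : ℤ) := by
  classical
  let e : Fin (n + r) ≃ Fin r ⊕ Fin n := (finCongr (Nat.add_comm n r)).trans finSumFinEquiv.symm
  let p : Fin r ⊕ Fin n → Prop := fun x => x.isLeft
  have hp : ∀ x : Fin (n + r), (x : ℕ) < r ↔ p (e x) := by
    intro x
    obtain ⟨y, rfl⟩ := e.symm.surjective x
    rw [Equiv.apply_symm_apply]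
    cases y <;> simp [e, p]
  have h1 : rDerangement r n =
      Nat.card {σ : Equiv.Perm (Fin r ⊕ Fin n) // (∀ x, σ x ≠ x) ∧ SepCycles p σ} := by
    refine Nat.card_congr (e.permCongr.subtypeEquiv fun σ => ?_)
    refine and_congr ?_ (sepCycles_conj e _ p hp σ)
    rw [← e.forall_congr_right]
    simp [Equiv.permCongr_apply]
  rw [h1, derange_incl_excl]
  have h2 : ∀ S : Finset (Fin r ⊕ Fin n), sepCount {x // x ∉ S} (fun x => p x) =
      (n - S.toRight.card + (r - S.toLeft.card)).choose (r - S.toLeft.card) *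
        (n - S.toRight.card).factorial := by
    intro S
    have hL : Nat.card {x : {x // x ∉ S} // p x} = r - S.toLeft.card := by
      have : {x : {x // x ∉ S} // p x} ≃ {a : Fin r // a ∈ S.toLeftᶜ} :=
        { toFun := fun x => match x with
            | ⟨⟨Sum.inl a, h⟩, _⟩ => ⟨a, by simpa using h⟩
            | ⟨⟨Sum.inr a, h⟩, h'⟩ => absurd h' (by simp [p])
          invFun := fun a => ⟨⟨Sum.inl a.1, by have := a.2; rwa [Finset.mem_compl, Finset.mem_toLeft] at this⟩, by simp [p]⟩
          left_inv := by
            rintro ⟨⟨a | a, h⟩, h'⟩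
            · rfl
            · exact absurd h' (by simp [p])
          right_inv := fun a => rfl }
      rw [Nat.card_congr this, Nat.card_eq_fintype_card, Fintype.card_coe, Finset.card_compl]
      simp
    have hT : Nat.card {x // x ∉ S} = n - S.toRight.card + (r - S.toLeft.card) := by
      have hl : S.toLeft.card ≤ r := by simpa using Finset.card_le_univ S.toLeft
      have hr : S.toRight.card ≤ n := by simpa using Finset.card_le_univ S.toRight
      have hc := Finset.card_toLeft_add_card_toRight (u := S)
      have : Nat.card {x // x ∉ S} = (Sᶜ).card := by
        rw [Nat.card_eq_fintype_card, Fintype.card_subtype]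
        congr 1; ext; simp
      rw [this, Finset.card_compl]
      simp
      omega
    have := sepCount_mul _ {x // x ∉ S} (fun x => p x) rfl
    rw [hL, hT, ← Nat.add_choose_mul_factorial_mul_factorial] at this
    refine Nat.eq_of_mul_eq_mul_right (Nat.factorial_pos _) this
  simp_rw [h2]
  rw [← Finset.sumEquiv.symm.toEquiv.sum_comp]
  rw [Fintype.sum_prod_type]
  simp only [OrderIso.toEquiv_symm, Finset.sumEquiv, Equiv.coe_fn_symm_mk, Finset.card_disjSum, Finset.toLeft_disjSum,
    Finset.toRight_disjSum]
  have key := fun (f : ℕ → ℤ) (m : ℕ) =>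
    Finset.sum_powerset_apply_card f (x := (Finset.univ : Finset (Fin m)))
  simp only [Finset.powerset_univ, Finset.card_univ, Fintype.card_fin] at key
  rw [key (fun s => ∑ T : Finset (Fin n), (-1) ^ (s + T.card) *
    (((n - T.card + (r - s)).choose (r - s) * (n - T.card).factorial : ℕ) : ℤ))]
  refine Finset.sum_congr rfl fun s _ => ?_
  rw [key (fun t => (-1) ^ (s + t) *
    (((n - t + (r - s)).choose (r - s) * (n - t).factorial : ℕ) : ℤ)), Finset.smul_sum]
  refine Finset.sum_congr rfl fun t _ => ?_
  simp only [nsmul_eq_mul]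
  ring

/-- Terms of the remainder coefficients. -/
noncomputable def remTerm (m n j : ℕ) : ℝ := ((n + j).choose n : ℝ) / (n + j + m).factorial

theorem remTerm_nonneg (m n j : ℕ) : 0 ≤ remTerm m n j := by unfold remTerm; positivity

theorem remTerm_zero (n j : ℕ) : remTerm 0 n j = (1 / n.factorial) * (1 / j.factorial) := by
  unfold remTerm
  have h := Nat.add_choose_mul_factorial_mul_factorial n j
  rw [← Nat.choose_symm_add] at h
  have h' : ((n + j).choose n : ℝ) * n.factorial * j.factorial = (n + j).factorial := by
    exact_mod_cast h
  rw [add_zero, ← h']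
  have : ((n + j).choose n : ℝ) ≠ 0 := by
    exact_mod_cast (Nat.choose_pos (Nat.le_add_right n j)).ne'
  have := Nat.factorial_ne_zero n
  have := Nat.factorial_ne_zero j
  field_simp

theorem remTerm_le (m n j : ℕ) : remTerm m n j ≤ (1 / n.factorial) * (1 / j.factorial) := by
  rw [← remTerm_zero]
  unfold remTerm
  gcongr
  omega

theorem hasSum_exp_one : HasSum (fun j : ℕ => (1 : ℝ) / j.factorial) (Real.exp 1) := by
  have := NormedSpace.expSeries_div_hasSum_exp (1 : ℝ)
  rw [← Real.exp_eq_exp_ℝ] at this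
  simpa using this

theorem remTerm_summable (m n : ℕ) : Summable (remTerm m n) :=
  Summable.of_nonneg_of_le (remTerm_nonneg m n) (remTerm_le m n)
    (hasSum_exp_one.summable.mul_left _)

/-- Absolute value of the remainder coefficients (times `e`). -/
noncomputable def remSum (m n : ℕ) : ℝ := ∑' j, remTerm m n j

theorem remSum_nonneg (m n : ℕ) : 0 ≤ remSum m n := tsum_nonneg (remTerm_nonneg m n)

theorem remSum_zero (n : ℕ) : remSum 0 n = (1 / n.factorial) * Real.exp 1 := by
  unfold remSum
  simp_rw [remTerm_zero]
  rw [tsum_mul_left, hasSum_exp_one.tsum_eq]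

theorem remSum_le (m n : ℕ) : remSum m n ≤ (1 / n.factorial) * Real.exp 1 := by
  rw [← remSum_zero]
  refine (remTerm_summable m n).tsum_le_tsum (fun j => ?_) (remTerm_summable 0 n)
  rw [remTerm_zero]; exact remTerm_le m n j

theorem remSum_step_zero (m : ℕ) : remSum m 0 = 1 / m.factorial + remSum (m + 1) 0 := by
  unfold remSum
  rw [(remTerm_summable m 0).tsum_eq_zero_add]
  congr 1
  · simp [remTerm]
  · refine tsum_congr fun j => ?_
    simp only [remTerm, Nat.choose_zero_right]
    congr 3
    ring

theorem remSum_step_succ (m n : ℕ) :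
    remSum m (n + 1) = remSum (m + 1) (n + 1) + remSum (m + 1) n := by
  have h0 : ∀ j, remTerm m (n + 1) j = remTerm (m + 1) n j +
      ((n + j).choose (n + 1) : ℝ) / (n + j + (m + 1)).factorial := by
    intro j
    unfold remTerm
    rw [← add_div, show n + 1 + j = n + j + 1 by ring, Nat.choose_succ_succ]
    push_cast
    rw [show n + j + 1 + m = n + j + (m + 1) by ring]
  have h1 : ∀ j, ((n + (j + 1)).choose (n + 1) : ℝ) / (n + (j + 1) + (m + 1)).factorial =
      remTerm (m + 1) (n + 1) j := by
    intro j
    unfold remTerm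
    rw [show n + (j + 1) = n + 1 + j by ring]
  have hs : Summable fun j => ((n + j).choose (n + 1) : ℝ) / (n + j + (m + 1)).factorial := by
    rw [← summable_nat_add_iff 1]
    simp_rw [h1]
    exact remTerm_summable _ _
  unfold remSum
  simp_rw [h0]
  rw [(remTerm_summable (m + 1) n).tsum_add hs, hs.tsum_eq_zero_add]
  simp_rw [h1]
  simp [add_comm]

/-- The remainder power series. -/
noncomputable def remSeries (m : ℕ) : PowerSeries ℝ :=
  PowerSeries.mk fun n => (Real.exp 1)⁻¹ * (-1) ^ n * remSum m n

theorem remSeries_step (m : ℕ) : remSeries m =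
    PowerSeries.C ((Real.exp 1)⁻¹ * (1 / m.factorial)) + (1 - PowerSeries.X) * remSeries (m + 1) := by
  ext n
  rw [sub_mul, one_mul, map_add, map_sub]
  cases n with
  | zero =>
    simp only [remSeries, PowerSeries.coeff_mk, PowerSeries.coeff_zero_X_mul,
      PowerSeries.coeff_zero_C]
    rw [remSum_step_zero]; ring
  | succ n =>
    rw [PowerSeries.coeff_succ_X_mul, PowerSeries.coeff_C, if_neg (Nat.succ_ne_zero n)]
    simp only [remSeries, PowerSeries.coeff_mk]
    rw [remSum_step_succ]; ring

theorem remSeries_expand (p : ℕ) : remSeries 0 =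
    ∑ l ∈ Finset.range p, PowerSeries.C ((Real.exp 1)⁻¹ * (1 / l.factorial)) *
      (1 - PowerSeries.X) ^ l + (1 - PowerSeries.X) ^ p * remSeries p := by
  induction p with
  | zero => simp
  | succ p ih =>
    rw [ih, remSeries_step p, Finset.sum_range_succ]
    ring

theorem coeff_identity (q n : ℕ) :
    ∑ t ∈ Finset.range (n + 1), (-1 : ℝ) ^ t / t.factorial * ((n - t + q).choose q : ℝ) =
      (Real.exp 1)⁻¹ * ∑ l ∈ Finset.range (q + 1),
        (1 : ℝ) / l.factorial * ((n + (q - l)).choose n : ℝ) +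
      (Real.exp 1)⁻¹ * (-1) ^ n * remSum (q + 1) n := by
  have h := congrArg (fun f => PowerSeries.coeff n
    (f * (PowerSeries.invOneSubPow ℝ (q + 1)).val)) (remSeries_expand (q + 1))
  simp only [add_mul, Finset.sum_mul, map_add, map_sum] at h
  have hl : PowerSeries.coeff n (remSeries 0 * (PowerSeries.invOneSubPow ℝ (q + 1)).val) =
      ∑ t ∈ Finset.range (n + 1), (-1 : ℝ) ^ t / t.factorial * ((n - t + q).choose q : ℝ) := by
    rw [PowerSeries.coeff_mul, Finset.Nat.sum_antidiagonal_eq_sum_range_succ_mk]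
    refine Finset.sum_congr rfl fun t _ => ?_
    rw [PowerSeries.invOneSubPow_val_succ_eq_mk_add_choose]
    simp only [remSeries, PowerSeries.coeff_mk, remSum_zero]
    rw [add_comm q]
    have := (Real.exp_pos 1).ne'
    field_simp
  have hr : (1 - PowerSeries.X) ^ (q + 1) * remSeries (q + 1) *
      (PowerSeries.invOneSubPow ℝ (q + 1)).val = remSeries (q + 1) := by
    have := PowerSeries.one_sub_pow_add_mul_invOneSubPow_val_eq_one_sub_pow ℝ 0 (q + 1)
    rw [zero_add, pow_zero] at this
    rw [mul_right_comm, this, one_mul]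
  rw [hl, hr] at h
  rw [h, Finset.mul_sum]
  congr 1
  · refine Finset.sum_congr rfl fun l hl => ?_
    have hlq : l ≤ q := Nat.lt_succ_iff.1 (Finset.mem_range.1 hl)
    have := PowerSeries.one_sub_pow_mul_invOneSubPow_val_add_eq_invOneSubPow_val ℝ (q - l + 1) l
    rw [show q - l + 1 + l = q + 1 by omega] at this
    rw [mul_assoc, this, PowerSeries.coeff_C_mul,
      PowerSeries.invOneSubPow_val_succ_eq_mk_add_choose, PowerSeries.coeff_mk, mul_assoc,
      add_comm n, ← Nat.choose_symm_add]
  · simp [remSeries]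

theorem main_sum_identity (r n : ℕ) (A : ℕ → ℕ → ℝ)
    (hA : ∀ k, A r k = ∑ i ∈ Finset.range (r + 1),
      (-1) ^ i * (r.choose i) * (if i ≤ k then (1 : ℝ) / (k - i).factorial else 0)) :
    ∑ k ∈ Finset.range (r + 1), A r k * ((n + r - k).choose n : ℝ) =
      ∑ s ∈ Finset.range (r + 1), (-1) ^ s * (r.choose s : ℝ) *
        ∑ l ∈ Finset.range (r - s + 1),
          (1 : ℝ) / l.factorial * ((n + (r - s - l)).choose n : ℝ) := by
  simp_rw [hA, Finset.sum_mul]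
  rw [Finset.sum_comm]
  refine Finset.sum_congr rfl fun s hs => ?_
  have hs' : s ≤ r := Nat.lt_succ_iff.1 (Finset.mem_range.1 hs)
  rw [Finset.mul_sum, show r + 1 = s + (r - s + 1) by omega, Finset.sum_range_add]
  rw [Finset.sum_eq_zero, zero_add]
  · refine Finset.sum_congr rfl fun l hl => ?_
    have hl' := Finset.mem_range.1 hl
    rw [if_pos (Nat.le_add_right s l), Nat.add_sub_cancel_left,
      show n + r - (s + l) = n + (r - s - l) by omega]
    ring
  · intro k hk
    have hk' := Finset.mem_range.1 hk
    rw [if_neg (by omega)]; simp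

theorem inv_factorial_bound (ε : ℝ) (hε : 0 < ε) (n : ℕ) :
    (1 : ℝ) / n.factorial ≤ Real.exp (1 / ε) * ε ^ n := by
  have h := Real.pow_div_factorial_le_exp (x := 1 / ε) (by positivity) n
  have h2 : (1 : ℝ) / n.factorial = (1 / ε) ^ n / n.factorial * ε ^ n := by
    rw [one_div_pow]; field_simp
  rw [h2]
  gcongr

theorem rDerangement_saddle_point (r : ℕ) (hr : 0 < r)
    (A : ℕ → ℕ → ℝ)
    (hA : ∀ k, A r k = ∑ i ∈ Finset.range (r + 1),
      (-1) ^ i * (r.choose i) * (if i ≤ k then (1 : ℝ) / (k - i).factorial else 0))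
    (ε : ℝ) (hε : 0 < ε) :
    ∃ M : ℝ, ∀ n : ℕ,
      |(rDerangement r n : ℝ) / n.factorial -
          (1 / Real.exp 1) * ∑ k ∈ Finset.range (r + 1),
            A r k * ((n + r - k).choose n : ℝ)| ≤ M * ε ^ n := by
  refine ⟨(∑ s ∈ Finset.range (r + 1), (r.choose s : ℝ)) * Real.exp (1 / ε), fun n => ?_⟩
  have hD : (rDerangement r n : ℝ) / n.factorial =
      ∑ s ∈ Finset.range (r + 1), (-1) ^ s * (r.choose s : ℝ) *
        ∑ t ∈ Finset.range (n + 1),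
          (-1 : ℝ) ^ t / t.factorial * ((n - t + (r - s)).choose (r - s) : ℝ) := by
    have h := congrArg (fun z : ℤ => (z : ℝ)) (rDerangement_eq r n)
    push_cast at h
    rw [h, Finset.sum_div]
    refine Finset.sum_congr rfl fun s _ => ?_
    rw [Finset.sum_div, Finset.mul_sum]
    refine Finset.sum_congr rfl fun t ht => ?_
    have ht' : t ≤ n := Nat.lt_succ_iff.1 (Finset.mem_range.1 ht)
    have hc : (n.choose t : ℝ) * t.factorial * (n - t).factorial = n.factorial := by
      exact_mod_cast Nat.choose_mul_factorial_mul_factorial ht'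
    have h1 : (n.factorial : ℝ) ≠ 0 := by exact_mod_cast Nat.factorial_ne_zero n
    have h2 : (t.factorial : ℝ) ≠ 0 := by exact_mod_cast Nat.factorial_ne_zero t
    rw [div_eq_iff h1, ← hc, pow_add]
    field_simp
  have hdiff : (rDerangement r n : ℝ) / n.factorial -
      (1 / Real.exp 1) * ∑ k ∈ Finset.range (r + 1), A r k * ((n + r - k).choose n : ℝ) =
      ∑ s ∈ Finset.range (r + 1), (-1) ^ s * (r.choose s : ℝ) *
        ((Real.exp 1)⁻¹ * (-1) ^ n * remSum (r - s + 1) n) := by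
    rw [hD, main_sum_identity r n A hA, Finset.mul_sum, ← Finset.sum_sub_distrib]
    refine Finset.sum_congr rfl fun s _ => ?_
    rw [coeff_identity]
    ring
  rw [hdiff, mul_assoc, Finset.sum_mul]
  refine (Finset.abs_sum_le_sum_abs _ _).trans (Finset.sum_le_sum fun s _ => ?_)
  simp only [abs_mul, abs_pow, abs_neg, abs_one, one_pow, one_mul, mul_one, Nat.abs_cast, abs_inv,
    Real.abs_exp, abs_of_nonneg (remSum_nonneg _ _)]
  refine mul_le_mul_of_nonneg_left ?_ (Nat.cast_nonneg _)
  refine le_trans ?_ (inv_factorial_bound ε hε n)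
  rw [inv_mul_le_iff₀ (Real.exp_pos 1), mul_comm]
  exact remSum_le _ _
end

section
/- For every r ∈ ℕ_+ and every n ≥ r, the product n!/(n-r)! = n(n-1)···(n-r+1) divides D_r(n); moreover the quotient C_r(n) := D_r(n)·(n-r)!/n! satisfies C_r(n) = Σ_{j=r}^n C(j,r)·(n-r)_{j-r}·(-1)^{n-j}, where (x)_k denotes the falling factorial. -/
open Equiv

/-- Elements satisfying `R` lie in pairwise distinct cycles. -/
def SepBy {α : Type} (R : α → Prop) (σ : Perm α) : Prop :=
  ∀ i j : α, R i → R j → i ≠ j → ¬ σ.SameCycle i j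

lemma sep_congr {α β : Type} (e : α ≃ β) (R : α → Prop) (R' : β → Prop)
    (h : ∀ a, R a ↔ R' (e a)) :
    Nat.card {σ : Perm α // SepBy R σ} = Nat.card {σ : Perm β // SepBy R' σ} := by
  refine Nat.card_congr (Equiv.subtypeEquiv e.permCongr ?_)
  intro σ
  have key : ∀ a b, (e.permCongr σ).SameCycle (e a) (e b) ↔ σ.SameCycle a b := by
    intro a b
    have hz : ∀ i : ℤ, (e.permCongr σ) ^ i = e.permCongr (σ ^ i) := by
      intro i
      exact (map_zpow e.permCongrHom σ i).symm
    unfold Perm.SameCycle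
    simp [hz, Equiv.permCongr_apply]
  constructor
  · intro H i j
    obtain ⟨i, rfl⟩ := e.surjective i
    obtain ⟨j, rfl⟩ := e.surjective j
    rw [← h, ← h, key]
    intro hi hj hij
    exact H i j hi hj (fun h => hij (by rw [h]))
  · intro H i j hi hj hij
    rw [← key]
    exact H _ _ ((h i).1 hi) ((h j).1 hj) (e.injective.ne hij)

lemma sameCycle_removeNone {α : Type} [Finite α] (σ : Perm (Option α)) (a b : α) :
    σ.SameCycle (some a) (some b) ↔ Perm.SameCycle (removeNone σ) a b := by
  constructor
  · intro h
    obtain ⟨n, hn⟩ := h.exists_nat_pow_eq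
    clear h
    induction n using Nat.strong_induction_on generalizing a with
    | _ n ih =>
      match n, hn with
      | 0, hn => 
        have : a = b := by simpa using hn
        subst this
        exact Perm.SameCycle.refl _ _
      | n + 1, hn =>
        rw [pow_succ, Perm.mul_apply] at hn
        refine Perm.sameCycle_apply_left.1 ?_
        cases hσ : σ (some a) with
        | some c =>
          have h1 := removeNone_some σ ⟨c, hσ⟩
          rw [← h1] at hn
          exact ih n (by omega) _ hn
        | none =>
          have h1 := removeNone_none σ hσ
          match n, hn with
          | 0, hn => simp [hσ] at hn
          | n + 1, hn =>
            rw [pow_succ, Perm.mul_apply, hσ, ← h1] at hn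
            exact ih n (by omega) _ hn
  · intro h
    obtain ⟨n, hn⟩ := h.exists_nat_pow_eq
    clear h
    induction n generalizing a with
    | zero => 
      have : a = b := by simpa using hn
      subst this
      exact Perm.SameCycle.refl _ _
    | succ n ih =>
      rw [pow_succ, Perm.mul_apply] at hn
      have h2 := ih _ hn
      cases hσ : σ (some a) with
      | some c =>
        rw [removeNone_some σ ⟨c, hσ⟩] at h2
        exact Perm.sameCycle_apply_left.1 h2
      | none =>
        rw [removeNone_none σ hσ, ← hσ] at h2
        exact Perm.sameCycle_apply_left.1 (Perm.sameCycle_apply_left.1 h2)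

lemma sep_option {α : Type} [Finite α] (R : Option α → Prop) (h : ¬ R none) :
    Nat.card {σ : Perm (Option α) // SepBy R σ} =
      (Nat.card α + 1) * Nat.card {σ : Perm α // SepBy (fun a => R (some a)) σ} := by
  classical
  rw [← Finite.card_option, ← Nat.card_prod]
  refine Nat.card_congr (Equiv.trans (Equiv.subtypeEquiv Perm.decomposeOption
    (q := fun p => SepBy (fun a => R (some a)) p.2) ?_) ?_)
  · intro σ
    have : (Perm.decomposeOption σ).2 = removeNone σ := rfl
    rw [this]
    constructor
    · intro H i j hi hj hij
      rw [← sameCycle_removeNone]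
      exact H _ _ hi hj (by simpa using hij)
    · intro H i j hi hj hij
      cases i with
      | none => exact absurd hi h
      | some i =>
        cases j with
        | none => exact absurd hj h
        | some j =>
          rw [sameCycle_removeNone]
          exact H _ _ hi hj (by simpa using hij)
  · exact
      { toFun := fun p => (p.1.1, ⟨p.1.2, p.2⟩)
        invFun := fun p => ⟨(p.1, p.2.1), p.2.2⟩
        left_inv := fun _ => rfl
        right_inv := fun _ => rfl }

lemma sep_card (m : ℕ) : ∀ (α : Type) [Finite α] (R : α → Prop),
    Nat.card {a // ¬ R a} = m →
    Nat.card {σ : Perm α // SepBy R σ} * (Nat.card {a // R a}).factorial =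
      (Nat.card α).factorial := by
  classical
  induction m with
  | zero =>
    intro α _ R h
    have hR : ∀ a, R a := by
      intro a
      by_contra ha
      rw [Finite.card_eq_zero_iff] at h
      exact h.false ⟨a, ha⟩
    have h1 : Nat.card {σ : Perm α // SepBy R σ} = 1 := by
      rw [Nat.card_eq_one_iff_unique]
      refine ⟨⟨?_⟩, ⟨⟨1, ?_⟩⟩⟩
      · have : ∀ σ : {σ : Perm α // SepBy R σ}, σ.1 = 1 := by
          rintro ⟨σ, hσ⟩
          ext x
          by_contra hx
          exact hσ x (σ x) (hR _) (hR _) (fun h => hx h.symm)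
            (Perm.sameCycle_apply_right.2 (Perm.SameCycle.refl _ _))
        intro a b
        exact Subtype.ext ((this a).trans (this b).symm)
      · intro i j _ _ hij
        simpa using hij
    have h2 : Nat.card {a // R a} = Nat.card α :=
      Nat.card_congr (Equiv.subtypeUnivEquiv hR)
    rw [h1, h2, one_mul]
  | succ m ih =>
    intro α _ R h
    have : Nonempty {a // ¬ R a} := by
      by_contra hc
      rw [not_nonempty_iff] at hc
      rw [Nat.card_of_isEmpty] at h
      omega
    obtain ⟨⟨a, ha⟩⟩ := this
    let e : Option {x // x ≠ a} ≃ α := Equiv.optionSubtypeNe a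
    have e1 := sep_congr e (fun x => R (e x)) R (fun _ => Iff.rfl)
    have e0 : e none = a := by simp [e]
    have e2 := sep_option (fun x => R (e x)) (by rw [e0]; exact ha)
    have e3 : Nat.card α = Nat.card {x // x ≠ a} + 1 := by
      rw [← Nat.card_congr e, Finite.card_option]
    have split : ∀ (β : Type) [Finite β] (Q : β → Prop), Nat.card {b // Q b} + Nat.card {b // ¬ Q b} = Nat.card β := by
      intro β _ Q
      rw [← Nat.card_sum]
      exact Nat.card_congr (Equiv.sumCompl Q)
    have e4 : Nat.card {x : {x // x ≠ a} // R (e (some x))} = Nat.card {x // R x} := by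
      refine Nat.card_congr (Equiv.trans (Equiv.subtypeSubtypeEquivSubtypeInter (fun x => x ≠ a) R |>.symm.symm) (Equiv.subtypeEquivRight ?_))
      intro x
      constructor
      · exact fun h => h.2
      · exact fun h => ⟨fun hx => ha (hx ▸ h), h⟩
    have s1 := split α R
    have s2 := split {x // x ≠ a} (fun x => R (e (some x)))
    have ih' := ih {x // x ≠ a} (fun x => R (e (some x))) (by omega)
    rw [← e1, e2, e3, Nat.factorial_succ, ← ih', e4, mul_assoc]

lemma fix_card {α : Type} [Finite α] (R F : α → Prop) :
    Nat.card {σ : Perm α // SepBy R σ ∧ ∀ x, F x → σ x = x} =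
      Nat.card {σ : Perm {x // ¬ F x} // SepBy (fun x => R x.1) σ} := by
  classical
  symm
  refine Nat.card_congr (Equiv.trans (Equiv.subtypeEquiv
    (Perm.subtypeEquivSubtypePerm (fun x => ¬ F x)) (q := fun p => SepBy R p.1) ?_) ?_)
  · intro σ
    set τ := Perm.subtypeEquivSubtypePerm (fun x => ¬ F x) σ with hτ
    have hσ : σ = (Perm.subtypeEquivSubtypePerm (fun x => ¬ F x)).symm τ := by simp [hτ]
    have key : ∀ a b, σ.SameCycle a b ↔ τ.1.SameCycle a b := by
      intro a b
      rw [hσ]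
      exact Perm.sameCycle_subtypePerm (h := fun x =>
        ⟨Decidable.not_imp_not.1 fun hfa => (τ.2 _ hfa).symm ▸ hfa,
          Decidable.not_imp_not.1 fun hfa => τ.1.injective (τ.2 _ hfa) ▸ hfa⟩)
    constructor
    · intro H i j hi hj hij hc
      by_cases h1 : F i
      · exact hij (hc.eq_of_left (τ.2 i (not_not.2 h1)))
      by_cases h2 : F j
      · exact hij (hc.eq_of_right (τ.2 j (not_not.2 h2)))
      exact H ⟨i, h1⟩ ⟨j, h2⟩ hi hj (by simpa using hij) ((key _ _).2 hc)
    · intro H i j hi hj hij hc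
      exact H i j hi hj (fun h => hij (Subtype.ext h)) ((key _ _).1 hc)
  · exact
      { toFun := fun p => ⟨p.1.1, p.2, fun x hx => p.1.2 x (not_not.2 hx)⟩
        invFun := fun p => ⟨⟨p.1, fun x hx => p.2.2 x (not_not.1 hx)⟩, p.2.1⟩
        left_inv := fun _ => rfl
        right_inv := fun _ => rfl }

lemma choose_sum (r m : ℕ) :
    ∑ a ∈ Finset.range (r + 1), (-1 : ℤ) ^ a * r.choose a * ((m + (r - a)).choose m : ℤ)
      = (m.choose r : ℤ) := by
  have h := fwdDiff_iter_eq_sum_shift (1 : ℕ) (fun x : ℕ => (x.choose m : ℤ)) r m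
  have h2 : ∑ a ∈ Finset.range (r + 1), (-1 : ℤ) ^ a * r.choose a * ((m + (r - a)).choose m : ℤ)
      = (fwdDiff 1)^[r] (fun x : ℕ => (x.choose m : ℤ)) m := by
    rw [h, ← Finset.sum_range_reflect]
    refine Finset.sum_congr rfl fun k hk => ?_
    have hk : k ≤ r := by simpa [Nat.lt_succ_iff] using hk
    have e1 : r + 1 - 1 - k = r - k := by omega
    have e2 : r - (r - k) = k := by omega
    rw [e1, e2, Nat.choose_symm hk]
    simp
  rw [h2]
  rcases le_or_gt r m with hrm | hrm
  · obtain ⟨j, rfl⟩ := Nat.exists_eq_add_of_le hrm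
    rw [fwdDiff_iter_choose]
    simp only
    rw [Nat.choose_symm_add]
  · obtain ⟨k, rfl⟩ := Nat.exists_eq_add_of_lt hrm
    rw [Nat.choose_eq_zero_of_lt hrm]
    simp_rw [(by ring : m + k + 1 = k + 1 + m), Function.iterate_add_apply,
      add_zero m ▸ fwdDiff_iter_choose 0 m, Nat.choose_zero_right, Function.iterate_one, Nat.cast_one, fwdDiff_const,
      fwdDiff_iter_eq_sum_shift, smul_zero, Finset.sum_const_zero, Nat.cast_zero]

lemma prod_ind {α : Type} [DecidableEq α] (A : Finset α) (σ : Perm α)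
    [Decidable (∀ x ∈ A, σ x ≠ x)] [∀ S : Finset α, Decidable (∀ x ∈ S, σ x = x)] :
    (if ∀ x ∈ A, σ x ≠ x then (1 : ℤ) else 0) =
      ∑ S ∈ A.powerset, (-1) ^ S.card * (if ∀ x ∈ S, σ x = x then (1 : ℤ) else 0) := by
  have h := Finset.prod_one_add (R := ℤ) (f := fun x => - (if σ x = x then (1 : ℤ) else 0)) A
  have h2 : ∏ x ∈ A, (1 + - (if σ x = x then (1 : ℤ) else 0)) =
      (if ∀ x ∈ A, σ x ≠ x then (1 : ℤ) else 0) := by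
    refine Eq.trans ?_ ((Finset.prod_boole (s := A) (p := fun x => σ x ≠ x)).trans
      (by congr))
    refine Finset.prod_congr rfl fun x _ => ?_
    by_cases hx : σ x = x <;> simp [hx]
  rw [← h2, h]
  refine Finset.sum_congr rfl fun S _ => ?_
  rw [Finset.prod_neg, Finset.prod_boole]
  congr

lemma ind_mul (P Q R U : Prop) [Decidable P] [Decidable Q] [Decidable R] [Decidable U]
    (h : P ↔ Q ∧ R ∧ U) : (if P then (1 : ℤ) else 0) =
      (if Q then 1 else 0) * ((if R then (1 : ℤ) else 0) * (if U then (1 : ℤ) else 0)) := by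
  by_cases hQ : Q <;> by_cases hR : R <;> by_cases hU : U <;> simp [h, hQ, hR, hU]

lemma incl_excl {α : Type} [Fintype α] [DecidableEq α] (A : Finset α) :
    (Nat.card {σ : Perm α // (∀ x, σ x ≠ x) ∧ SepBy (· ∈ A) σ} : ℤ) =
      ∑ S ∈ A.powerset, ∑ T ∈ Aᶜ.powerset, (-1) ^ S.card * (-1) ^ T.card *
        (Nat.card {σ : Perm α // SepBy (· ∈ A) σ ∧ ∀ x, x ∈ S ∪ T → σ x = x} : ℤ) := by
  classical
  have conv : ∀ (P : Perm α → Prop) [DecidablePred P], (Nat.card {σ : Perm α // P σ} : ℤ) = ∑ σ, if P σ then 1 else 0 := by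
    intro P _
    rw [Nat.card_eq_fintype_card, Fintype.card_subtype]
    simp
  simp_rw [conv, Finset.mul_sum]
  have : ∀ S ∈ A.powerset, ∑ T ∈ Aᶜ.powerset, ∑ σ : Perm α, (-1 : ℤ) ^ S.card * (-1) ^ T.card *
        (if SepBy (· ∈ A) σ ∧ ∀ x, x ∈ S ∪ T → σ x = x then 1 else 0) =
      ∑ σ : Perm α, ∑ T ∈ Aᶜ.powerset, (-1 : ℤ) ^ S.card * (-1) ^ T.card *
        (if SepBy (· ∈ A) σ ∧ ∀ x, x ∈ S ∪ T → σ x = x then 1 else 0) := fun S _ => Finset.sum_comm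
  rw [Finset.sum_congr rfl this, Finset.sum_comm]
  refine Finset.sum_congr rfl fun σ _ => ?_
  have h1 : (if (∀ x, σ x ≠ x) ∧ SepBy (· ∈ A) σ then (1 : ℤ) else 0) =
      (if SepBy (· ∈ A) σ then 1 else 0) * ((if ∀ x ∈ A, σ x ≠ x then (1 : ℤ) else 0) *
        (if ∀ x ∈ Aᶜ, σ x ≠ x then (1 : ℤ) else 0)) := by
    refine ind_mul _ _ _ _ ?_
    constructor
    · rintro ⟨h, h'⟩
      exact ⟨h', fun x _ => h x, fun x _ => h x⟩
    · rintro ⟨h', h, h2⟩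
      refine ⟨fun x => ?_, h'⟩
      by_cases hx : x ∈ A
      · exact h x hx
      · exact h2 x (Finset.mem_compl.2 hx)
  rw [h1, prod_ind, prod_ind, Finset.sum_mul_sum, Finset.mul_sum]
  refine Finset.sum_congr rfl fun S _ => ?_
  rw [Finset.mul_sum]
  refine Finset.sum_congr rfl fun T _ => ?_
  have h3 : (if SepBy (· ∈ A) σ ∧ ∀ x, x ∈ S ∪ T → σ x = x then (1 : ℤ) else 0) =
      (if SepBy (· ∈ A) σ then 1 else 0) * ((if ∀ x ∈ S, σ x = x then (1 : ℤ) else 0) *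
        (if ∀ x ∈ T, σ x = x then (1 : ℤ) else 0)) := by
    refine ind_mul _ _ _ _ ?_
    simp only [Finset.mem_union, or_imp, forall_and]
  rw [h3]
  ring

lemma term_card {α : Type} [Fintype α] [DecidableEq α] (A S T : Finset α) (hS : S ⊆ A)
    (hT : T ⊆ Aᶜ) :
    Nat.card {σ : Perm α // SepBy (· ∈ A) σ ∧ ∀ x, x ∈ S ∪ T → σ x = x} =
      (Aᶜ.card - T.card).factorial *
        ((Aᶜ.card - T.card) + (A.card - S.card)).choose (Aᶜ.card - T.card) := by
  classical
  rw [fix_card (· ∈ A) (· ∈ S ∪ T)]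
  have h := sep_card _ {x // ¬ x ∈ S ∪ T} (fun x => x.1 ∈ A) rfl
  have c1 : Nat.card {x : {x // ¬ x ∈ S ∪ T} // x.1 ∈ A} = A.card - S.card := by
    rw [← Finset.card_sdiff_of_subset hS, ← Nat.card_eq_finsetCard]
    refine Nat.card_congr ((Equiv.subtypeSubtypeEquivSubtypeInter (fun x => ¬ x ∈ S ∪ T)
      (· ∈ A)).trans (Equiv.subtypeEquivRight ?_))
    intro x
    have := @hT x
    simp only [Finset.mem_union, Finset.mem_sdiff, Finset.mem_compl] at *
    tauto
  have c2 : Nat.card {x // ¬ x ∈ S ∪ T} = (Aᶜ.card - T.card) + (A.card - S.card) := by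
    have hd : Disjoint S T := Finset.disjoint_of_subset_left hS
      (Finset.disjoint_of_subset_right hT disjoint_compl_right)
    have d1 := Finset.card_union_of_disjoint hd
    have d2 := Finset.card_le_card hS
    have d3 := Finset.card_le_card hT
    have d4 := Finset.card_compl_add_card A
    have d5 := Finset.card_compl_add_card (S ∪ T)
    have d6 : Nat.card {x // ¬ x ∈ S ∪ T} = (S ∪ T)ᶜ.card := by
      rw [← Nat.card_eq_finsetCard]
      exact Nat.card_congr (Equiv.subtypeEquivRight fun x => by simp)
    omega
  rw [c1, c2] at h
  have h2 := Nat.add_choose_mul_factorial_mul_factorial (Aᶜ.card - T.card) (A.card - S.card)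
  refine Nat.eq_of_mul_eq_mul_right (Nat.factorial_pos (A.card - S.card)) ?_
  rw [h, ← h2, Nat.choose_symm_add]
  ring

lemma main_count {α : Type} [Fintype α] [DecidableEq α] (A : Finset α) (r n : ℕ) (hA : A.card = r)
    (hA' : Aᶜ.card = n) :
    (Nat.card {σ : Perm α // (∀ x, σ x ≠ x) ∧ SepBy (· ∈ A) σ} : ℤ) =
      ∑ b ∈ Finset.range (n + 1), (-1 : ℤ) ^ b * n.choose b * ((n - b).factorial * (n - b).choose r : ℤ) := by
  rw [incl_excl]
  have : ∀ S ∈ A.powerset, ∑ T ∈ Aᶜ.powerset, (-1) ^ S.card * (-1) ^ T.card *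
        (Nat.card {σ : Perm α // SepBy (· ∈ A) σ ∧ ∀ x, x ∈ S ∪ T → σ x = x} : ℤ) =
      ∑ b ∈ Finset.range (n + 1), n.choose b • ((-1) ^ S.card * (-1) ^ b *
        (((n - b).factorial * ((n - b) + (r - S.card)).choose (n - b) : ℕ) : ℤ)) := by
    intro S hS
    rw [← hA', ← Finset.sum_powerset_apply_card (fun b => (-1) ^ S.card * (-1) ^ b *
        (((Aᶜ.card - b).factorial * ((Aᶜ.card - b) + (r - S.card)).choose (Aᶜ.card - b) : ℕ) : ℤ))]
    refine Finset.sum_congr rfl fun T hT => ?_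
    rw [term_card A S T (Finset.mem_powerset.1 hS) (Finset.mem_powerset.1 hT), hA]
  rw [Finset.sum_congr rfl this, Finset.sum_comm]
  refine Finset.sum_congr rfl fun b _ => ?_
  rw [Finset.sum_powerset_apply_card (fun a => n.choose b • ((-1) ^ a * (-1) ^ b *
        (((n - b).factorial * ((n - b) + (r - a)).choose (n - b) : ℕ) : ℤ))), hA,
    ← choose_sum r (n - b), Finset.mul_sum, Finset.mul_sum]
  refine Finset.sum_congr rfl fun a _ => ?_
  push_cast [nsmul_eq_mul]
  ring

theorem descFactorial_dvd_rDerangement (r n : ℕ) (hr : 0 < r) (hn : r ≤ n) :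
    n.descFactorial r ∣ rDerangement r n ∧
      ((rDerangement r n / n.descFactorial r : ℕ) : ℤ) =
        ∑ j ∈ Finset.Icc r n,
          (j.choose r : ℤ) * ((n - r).descFactorial (j - r) : ℤ) * (-1) ^ (n - j) := by
  classical
  have hpos : 0 < n.descFactorial r := Nat.descFactorial_pos.2 hn
  have key : (rDerangement r n : ℤ) = n.descFactorial r * ∑ j ∈ Finset.Icc r n,
          (j.choose r : ℤ) * ((n - r).descFactorial (j - r) : ℤ) * (-1) ^ (n - j) := by
    let A : Finset (Fin (n + r)) := Finset.univ.filter (fun i => (i : ℕ) < r)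
    have hA : A.card = r := by
      simp [A, Fin.card_filter_val_lt]
    have hA' : Aᶜ.card = n := by
      rw [Finset.card_compl, hA, Fintype.card_fin]; omega
    have h0 : rDerangement r n =
        Nat.card {σ : Perm (Fin (n + r)) // (∀ x, σ x ≠ x) ∧ SepBy (· ∈ A) σ} := by
      unfold rDerangement SepBy
      simp [A]
    rw [h0, main_count A r n hA hA', ← Finset.sum_range_reflect, Finset.mul_sum]
    symm
    refine Finset.sum_subset_zero_on_sdiff ?_ ?_ ?_
    · intro j hj
      simp at hj ⊢
      omega
    · intro j hj
      simp only [Finset.mem_sdiff, Finset.mem_range, Finset.mem_Icc, not_and] at hj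
      have : n - (n + 1 - 1 - j) < r := by omega
      rw [Nat.choose_eq_zero_of_lt this]
      simp
    · intro j hj
      rw [Finset.mem_Icc] at hj
      have e1 : n + 1 - 1 - j = n - j := by omega
      have e2 : n - (n - j) = j := by omega
      rw [e1, e2, Nat.choose_symm hj.2]
      have e3 : n.choose j * j.factorial = n.descFactorial r * (n - r).descFactorial (j - r) := by
        rw [mul_comm, ← Nat.descFactorial_eq_factorial_mul_choose]
        have := Nat.descFactorial_mul_descFactorial (n := n) hj.1
        rw [← this]; ring
      have e4 : (n.choose j : ℤ) * j.factorial = n.descFactorial r * (n - r).descFactorial (j - r) := by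
        exact_mod_cast e3
      linear_combination (-(-1 : ℤ) ^ (n - j) * j.choose r) * e4
  have hdvd : n.descFactorial r ∣ rDerangement r n := by
    rw [← Int.natCast_dvd_natCast]
    exact ⟨_, key⟩
  refine ⟨hdvd, ?_⟩
  obtain ⟨q, hq⟩ := hdvd
  rw [hq, Nat.mul_div_cancel_left _ hpos]
  rw [hq] at key
  push_cast at key
  exact mul_left_cancel₀ (by exact_mod_cast hpos.ne') key
end

section
/- For every r ∈ ℕ_+, the set of prime numbers p such that p divides C_r(n) for some n ≥ r is infinite. -/
/-- `C_r(n) = D_r(n) · (n-r)!/n! = D_r(n) / (n·(n-1)⋯(n-r+1))`. -/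
noncomputable def Cr (r n : ℕ) : ℕ :=
  rDerangement r n / n.descFactorial r

/-- Permutations with no fixed points in `F`, and elements of `M` in distinct cycles. -/
def Good {α : Type} (M F : Set α) (σ : Equiv.Perm α) : Prop :=
  (∀ x ∈ F, σ x ≠ x) ∧ ∀ i ∈ M, ∀ j ∈ M, i ≠ j → ¬ σ.SameCycle i j

noncomputable def NN (α : Type) (M F : Set α) : ℕ := Nat.card {σ : Equiv.Perm α // Good M F σ}

lemma sc_of_step {α : Type} [Finite α] (f : Equiv.Perm α) (R : α → α → Prop)
    (hrefl : ∀ x, R x x) (htrans : ∀ x y z, R x y → R y z → R x z)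
    (h : ∀ x, R x (f x)) {x y : α} (hs : f.SameCycle x y) : R x y := by
  obtain ⟨n, rfl⟩ := hs.exists_nat_pow_eq
  induction n with
  | zero => simpa using hrefl x
  | succ n ih =>
    rw [pow_succ', Equiv.Perm.mul_apply]
    exact htrans _ _ _ (ih ⟨n, by simp⟩) (h _)

lemma sc_optionCongr {α : Type} [Finite α] (e : Equiv.Perm α) (a b : α) :
    Equiv.Perm.SameCycle (Equiv.optionCongr e : Equiv.Perm (Option α)) (some a) (some b) ↔ e.SameCycle a b := by
  constructor
  · intro h
    have := sc_of_step (Equiv.optionCongr e : Equiv.Perm (Option α))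
      (fun x y => ∀ a, x = some a → ∃ b, y = some b ∧ e.SameCycle a b) ?_ ?_ ?_ h
    · obtain ⟨b', h1, h2⟩ := this a rfl
      cases h1; exact h2
    · intro x a h; exact ⟨a, h, .refl _ _⟩
    · intro x y z h1 h2 a ha
      obtain ⟨b, hb, hb'⟩ := h1 a ha
      obtain ⟨c, hc, hc'⟩ := h2 b hb
      exact ⟨c, hc, hb'.trans hc'⟩
    · rintro x a rfl
      exact ⟨e a, by simp, ⟨1, by simp⟩⟩
  · intro h
    refine sc_of_step e (fun a b => Equiv.Perm.SameCycle (Equiv.optionCongr e : Equiv.Perm (Option α)) (some a) (some b))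
      (fun x => .refl _ _) (fun x y z h1 h2 => h1.trans h2) ?_ h
    intro x
    exact ⟨1, by simp⟩

lemma sc_decompose {α : Type} [Finite α] [DecidableEq α] (i : Option α) (e : Equiv.Perm α) (a b : α) :
    Equiv.Perm.SameCycle (Equiv.Perm.decomposeOption.symm (i, e)) (some a) (some b) ↔ e.SameCycle a b := by
  rcases i with _ | c
  · rw [← sc_optionCongr e, Equiv.Perm.decomposeOption_symm_apply]
    simp only [Equiv.swap_self]
    exact Iff.rfl
  set τ := Equiv.Perm.decomposeOption.symm (some c, e) with hτ
  have h1 : τ none = some c := by simp [hτ]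
  have h2 : ∀ a, e a ≠ c → τ (some a) = some (e a) := by
    intro a ha
    simp only [hτ, Equiv.Perm.decomposeOption_symm_apply, Equiv.Perm.mul_apply, Equiv.optionCongr_apply, Option.map_some]
    exact Equiv.swap_apply_of_ne_of_ne (by simp) (by simpa using ha)
  have h3 : ∀ a, e a = c → τ (some a) = none := by
    intro a ha
    simp [hτ, Equiv.Perm.decomposeOption_symm_apply, ha]
  constructor
  · intro h
    have := sc_of_step τ (fun x y => e.SameCycle (x.getD c) (y.getD c))
      (fun x => .refl _ _) (fun x y z h1 h2 => h1.trans h2) ?_ h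
    · simpa using this
    · rintro (_ | x)
      · rw [h1]; exact .refl _ _
      · by_cases hx : e x = c
        · rw [h3 x hx]; exact ⟨1, by simpa using hx⟩
        · rw [h2 x hx]; exact ⟨1, by simp⟩
  · intro h
    refine sc_of_step e (fun a b => τ.SameCycle (some a) (some b))
      (fun x => .refl _ _) (fun x y z h1 h2 => h1.trans h2) ?_ h
    intro x
    by_cases hx : e x = c
    · exact ⟨2, by
        have : (τ ^ (2 : ℤ)) (some x) = τ (τ (some x)) := by
          rw [zpow_two, Equiv.Perm.mul_apply]
        exact this.trans (by rw [h3 x hx, h1, hx])⟩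
    · exact ⟨1, by simpa using h2 x hx⟩

lemma step1_opt {α : Type} [Finite α] (M : Set (Option α)) (hM : none ∉ M) :
    NN (Option α) M ∅ = (Nat.card α + 1) * NN α (some ⁻¹' M) ∅ := by
  classical
  unfold NN
  rw [← Finite.card_option, ← Nat.card_prod]
  refine Nat.card_congr ?_
  refine Equiv.trans (Equiv.subtypeEquiv (q := fun p : Option α × Equiv.Perm α => Good (some ⁻¹' M) ∅ p.2)
    Equiv.Perm.decomposeOption ?_) ?_
  · intro σ
    obtain ⟨⟨i, e⟩, rfl⟩ := Equiv.Perm.decomposeOption.symm.surjective σ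
    simp only [Equiv.apply_symm_apply, Good, true_and, Set.mem_empty_iff_false, false_imp_iff, implies_true]
    constructor
    · intro h a ha b hb hab hs
      exact h _ ha _ hb (by simpa using hab) ((sc_decompose i e a b).mpr hs)
    · rintro h (_ | a) ha (_ | b) hb hab hs
      · exact hM ha
      · exact hM ha
      · exact hM hb
      · exact h a ha b hb (by simpa using hab) ((sc_decompose i e a b).mp hs)
  · exact { toFun := fun p => (p.1.1, ⟨p.1.2, p.2⟩), invFun := fun p => ⟨(p.1, p.2.1), p.2.2⟩,
            left_inv := fun _ => rfl, right_inv := fun _ => rfl }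

lemma step2_opt {α : Type} [Finite α] (M F : Set (Option α)) (hF : none ∉ F) :
    NN (Option α) M F = NN (Option α) M (insert none F) + NN α (some ⁻¹' M) (some ⁻¹' F) := by
  classical
  unfold NN
  rw [← Nat.card_congr (Equiv.sumCompl (fun σ : {σ : Equiv.Perm (Option α) // Good M F σ} => σ.1 none ≠ none)),
    Nat.card_sum]
  congr 1
  · refine Nat.card_congr ((Equiv.subtypeSubtypeEquivSubtypeInter (Good M F) (fun σ => σ none ≠ none)).trans
      (Equiv.subtypeEquivRight ?_))
    intro σ
    simp only [Good, Set.mem_insert_iff, forall_eq_or_imp]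
    tauto
  · refine Nat.card_congr ((Equiv.subtypeSubtypeEquivSubtypeInter (Good M F) (fun σ => ¬ σ none ≠ none)).trans ?_)
    symm
    refine Equiv.ofBijective (fun e => ⟨Equiv.optionCongr e.1, ?_, by simp⟩) ⟨?_, ?_⟩
    · obtain ⟨e, he1, he2⟩ := e
      refine ⟨?_, ?_⟩
      · rintro (_ | x) hx
        · exact absurd hx hF
        · simpa using he1 x hx
      · have key : ∀ b, ¬ Equiv.Perm.SameCycle (Equiv.optionCongr e : Equiv.Perm (Option α)) none (some b) := by
          intro b hb
          have := hb.eq_of_left (by simp [Function.IsFixedPt])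
          simp at this
        rintro (_ | a) ha (_ | b) hb hab hs
        · exact hab rfl
        · exact key _ hs
        · exact key _ hs.symm
        · exact he2 a ha b hb (by simpa using hab) ((sc_optionCongr e a b).mp hs)
    · rintro ⟨e, he⟩ ⟨e', he'⟩ h
      simp only [Subtype.mk.injEq] at h
      exact Subtype.ext (Equiv.optionCongr_injective h)
    · rintro ⟨σ, hσ, hn⟩
      push Not at hn
      have hσe : Equiv.optionCongr (Equiv.removeNone σ) = σ := by
        have := Equiv.Perm.decomposeOption.symm_apply_apply σ
        rw [Equiv.Perm.decomposeOption_symm_apply] at this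
        simp only [Equiv.Perm.decomposeOption_apply, hn, Equiv.swap_self] at this
        exact this
      refine ⟨⟨Equiv.removeNone σ, ?_, ?_⟩, ?_⟩
      · intro x hx h
        apply hσ.1 (some x) hx
        rw [← hσe, Equiv.optionCongr_apply, Option.map_some, h]
      · intro a ha b hb hab hs
        apply hσ.2 _ ha _ hb (by simpa using hab)
        rw [← hσe]; exact (sc_optionCongr _ a b).mpr hs
      · exact Subtype.ext hσe

lemma NN_congr {α β : Type} (e : α ≃ β) (M F : Set β) : NN β M F = NN α (e ⁻¹' M) (e ⁻¹' F) := by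
  unfold NN
  symm
  refine Nat.card_congr (Equiv.subtypeEquiv e.permCongr ?_)
  intro σ
  have hsc : ∀ i j, Equiv.Perm.SameCycle (e.permCongr σ) (e i) (e j) ↔ σ.SameCycle i j := by
    intro i j
    have : ∀ k : ℤ, (e.permCongr σ) ^ k = e.permCongr (σ ^ k) := fun k => (map_zpow e.permCongrHom σ k).symm
    simp [Equiv.Perm.SameCycle, this]
  unfold Good
  rw [← e.forall_congr_right (q := fun x => x ∈ F → (e.permCongr σ) x ≠ x)]
  rw [← e.forall_congr_right (q := fun i => i ∈ M → ∀ j ∈ M, i ≠ j → ¬ (e.permCongr σ).SameCycle i j)]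
  simp only [← e.forall_congr_right (q := fun j => j ∈ M → _ ≠ j → ¬ (e.permCongr σ).SameCycle _ j), hsc]
  simp

lemma step1 {α : Type} [Finite α] (M : Set α) (x : α) (hM : x ∉ M) :
    NN α M ∅ = Nat.card α * NN {y // y ≠ x} (Subtype.val ⁻¹' M) ∅ := by
  classical
  rw [NN_congr (Equiv.optionSubtypeNe x), Set.preimage_empty, step1_opt _ (by simpa using hM),
    ← Finite.card_option, Nat.card_congr (Equiv.optionSubtypeNe x)]
  congr 2

lemma step2 {α : Type} [Finite α] (M F : Set α) (x : α) (hF : x ∉ F) :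
    NN α M F = NN α M (insert x F) + NN {y // y ≠ x} (Subtype.val ⁻¹' M) (Subtype.val ⁻¹' F) := by
  classical
  rw [NN_congr (Equiv.optionSubtypeNe x), step2_opt _ _ (by simpa using hF),
    NN_congr (Equiv.optionSubtypeNe x) M (insert x F)]
  congr 2
  ext y
  rcases y with _ | y
  · simp
  · simp [y.2]

lemma card_val_not_mem {α : Type} (x : α) (S : Set α) (hx : x ∉ S) :
    ((Subtype.val : {y // y ≠ x} → α) ⁻¹' S).ncard = S.ncard := by
  apply Set.ncard_preimage_of_injective_subset_range Subtype.val_injective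
  intro y hy
  exact ⟨⟨y, fun h => hx (h ▸ hy)⟩, rfl⟩

lemma card_val_mem {α : Type} [Finite α] (x : α) (S : Set α) (hx : x ∈ S) :
    ((Subtype.val : {y // y ≠ x} → α) ⁻¹' S).ncard + 1 = S.ncard := by
  rw [← Set.ncard_sdiff_singleton_add_one hx, ← card_val_not_mem x (S \ {x}) (by simp)]
  congr 2
  ext y
  simp [y.2]

lemma thm1 (n : ℕ) : ∀ (t : ℕ) (α : Type) [Finite α] (M : Set α), Mᶜ.ncard = n → M.ncard = t →
    NN α M ∅ * t.factorial = (n + t).factorial := by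
  induction n with
  | zero =>
    intro t α _ M h0 ht
    have hM : M = Set.univ := by
      rw [Set.ncard_eq_zero] at h0
      simpa using h0
    subst hM
    have : NN α Set.univ ∅ = 1 := by
      unfold NN
      rw [Nat.card_eq_one_iff_unique]
      refine ⟨⟨?_⟩, ⟨⟨1, by simp [Good]⟩⟩⟩
      have key : ∀ σ : Equiv.Perm α, Good Set.univ ∅ σ → σ = 1 := by
        intro σ hσ
        ext x
        by_contra hx
        exact hσ.2 x trivial (σ x) trivial (fun h => hx h.symm) ⟨1, by simp⟩
      rintro ⟨σ, hσ⟩ ⟨τ, hτ⟩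
      exact Subtype.ext ((key σ hσ).trans (key τ hτ).symm)
    simp [this]
  | succ n ih =>
    intro t α _ M hn ht
    have hne : Mᶜ.Nonempty := by
      rw [← Set.ncard_pos]; omega
    obtain ⟨x, hx⟩ := hne
    have hx' : x ∉ M := hx
    have hc : Nat.card α = n + t + 1 := by
      rw [← Set.ncard_add_ncard_compl M]; omega
    have h1 := card_val_mem x Mᶜ hx
    rw [step1 M x hx', mul_assoc, ih t {y // y ≠ x} _ (by rw [← Set.preimage_compl]; omega)
      (by rw [card_val_not_mem x M hx', ht]), hc, show n + 1 + t = n + t + 1 by ring, Nat.factorial_succ]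

lemma thm2 (g : ℕ) : ∀ (n t : ℕ) (α : Type) [Finite α] (M F : Set α), F ⊆ M → F.ncard = g →
    Mᶜ.ncard = n → M.ncard = g + t → NN α M F = n.factorial * (n + t).choose (g + t) := by
  induction g with
  | zero =>
    intro n t α _ M F _ hF hn ht
    have : F = ∅ := by rwa [Set.ncard_eq_zero] at hF
    subst this
    have := thm1 n t α M hn (by omega)
    have h2 := Nat.add_choose_mul_factorial_mul_factorial n t
    rw [zero_add]
    apply Nat.eq_of_mul_eq_mul_right (Nat.factorial_pos t)
    rw [this, ← h2]; ring
  | succ g ih =>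
    intro n t α _ M F hFM hF hn ht
    have hne : F.Nonempty := by
      rw [← Set.ncard_pos]; omega
    obtain ⟨x, hx⟩ := hne
    have h0 := step2 M (F \ {x}) x (by simp)
    rw [Set.insert_sdiff_singleton, Set.insert_eq_of_mem hx] at h0
    have hg : (F \ {x}).ncard = g := by
      have := Set.ncard_sdiff_singleton_add_one hx; omega
    have hm := card_val_mem x M (hFM hx)
    rw [ih n (t+1) α M (F \ {x}) (Set.sdiff_subset.trans hFM) hg hn (by omega),
      ih n t {y // y ≠ x} _ _ (Set.preimage_mono (Set.sdiff_subset.trans hFM))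
        (by rw [card_val_not_mem x _ (by simp), hg])
        (by rw [← Set.preimage_compl, card_val_not_mem x _ (by simpa using hFM hx), hn]) (by omega),
      ← add_assoc, ← add_assoc, Nat.choose_succ_succ] at h0
    have : g + 1 + t = g + t + 1 := by ring
    rw [this]
    simp only [Nat.succ_eq_add_one] at h0
    rw [mul_add] at h0
    omega

lemma thm3 (r f : ℕ) : ∀ (u : ℕ) (α : Type) [Finite α] (M F : Set α), M ⊆ F → (F \ M).ncard = f →
    Mᶜ.ncard = f + u → M.ncard = r →
    (NN α M F : ℤ) = (fwdDiff 1)^[f] (fun k : ℕ => ((k.factorial * k.choose r : ℕ) : ℤ)) u := by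
  induction f with
  | zero =>
    intro u α _ M F hMF hf hn hr
    have h1 : F \ M = ∅ := by rwa [Set.ncard_eq_zero] at hf
    have : F = M := Set.Subset.antisymm (Set.sdiff_eq_empty.mp h1) hMF
    subst this
    rw [thm2 r (0 + u) 0 α F F le_rfl hr hn hr]
    simp
  | succ f ih =>
    intro u α _ M F hMF hf hn hr
    have hne : (F \ M).Nonempty := by
      rw [← Set.ncard_pos]; omega
    obtain ⟨x, hx⟩ := hne
    have hxM : x ∉ M := hx.2
    have hMF' : M ⊆ F \ {x} := fun y hy => ⟨hMF hy, fun h => hxM (h ▸ hy)⟩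
    have h0 := step2 M (F \ {x}) x (by simp)
    rw [Set.insert_sdiff_singleton, Set.insert_eq_of_mem hx.1] at h0
    have hg : ((F \ {x}) \ M).ncard = f := by
      have := Set.ncard_sdiff_singleton_add_one hx
      rw [show (F \ {x}) \ M = (F \ M) \ {x} by ext y; simp; tauto]; omega
    have hm := card_val_mem x Mᶜ hxM
    have e1 := ih (u + 1) α M (F \ {x}) hMF' hg (by omega) hr
    have e2 := ih u {y // y ≠ x} (Subtype.val ⁻¹' M) (Subtype.val ⁻¹' (F \ {x})) (Set.preimage_mono hMF')
      (by rw [← Set.preimage_sdiff, card_val_not_mem x _ (by simp), hg])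
      (by rw [← Set.preimage_compl]; omega) (by rw [card_val_not_mem x M hxM, hr])
    rw [Function.iterate_succ_apply', fwdDiff, ← e1, ← e2, h0]
    push_cast; ring

lemma rDer_eq (r n : ℕ) : (rDerangement r n : ℤ) =
    (fwdDiff 1)^[n] (fun k : ℕ => ((k.factorial * k.choose r : ℕ) : ℤ)) 0 := by
  have hM : ({i : Fin (n + r) | (i : ℕ) < r} : Set _).ncard = r := by
    have : ({i : Fin (n + r) | (i : ℕ) < r} : Set _) = Set.range (Fin.castLE (Nat.le_add_left r n)) := by
      ext i
      simp only [Set.mem_ofPred_eq, Set.mem_range]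
      exact ⟨fun h => ⟨⟨i, h⟩, rfl⟩, by rintro ⟨j, rfl⟩; exact j.2⟩
    rw [this, ← Set.image_univ, Set.ncard_image_of_injective _ (Fin.castLE_injective _)]
    simp
  have hc : ({i : Fin (n + r) | (i : ℕ) < r} : Set _)ᶜ.ncard = n := by
    have := Set.ncard_add_ncard_compl ({i : Fin (n + r) | (i : ℕ) < r} : Set _)
    rw [Nat.card_fin] at this
    omega
  rw [← thm3 r n 0 (Fin (n + r)) {i | (i : ℕ) < r} Set.univ (Set.subset_univ _)
    (by rw [← Set.compl_eq_univ_sdiff, hc]) (by rw [hc]; rfl) hM]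
  unfold rDerangement NN Good
  congr 1
  refine Nat.card_congr (Equiv.subtypeEquivRight ?_)
  intro σ
  simp only [Set.mem_univ, true_imp_iff, Set.mem_ofPred_eq]
  grind

/-- The alternating sum for `C_r(m + r)`. -/
def cc (r m : ℕ) : ℤ := ∑ k ∈ Finset.range (m + 1), (-1) ^ (m - k) * ((m.descFactorial k * (k + r).choose r : ℕ) : ℤ)

lemma rDer_cc (r m : ℕ) : (rDerangement r (m + r) : ℤ) = ((m + r).descFactorial r : ℤ) * cc r m := by
  rw [rDer_eq, fwdDiff_iter_eq_sum_shift, show m + r + 1 = r + (m + 1) by ring, Finset.sum_range_add,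
    Finset.sum_eq_zero, zero_add, cc, Finset.mul_sum]
  · refine Finset.sum_congr rfl fun k hk => ?_
    have hk' : k ≤ m := by simpa [Nat.lt_succ_iff] using hk
    have e : m + r - (r + k) = m - k := by omega
    have key : (m + r).choose (r + k) * (r + k).factorial = (m + r).descFactorial r * m.descFactorial k := by
      rw [mul_comm, ← Nat.descFactorial_eq_factorial_mul_choose, add_comm r k]
      have := Nat.descFactorial_mul_descFactorial (n := m + r) (k := r) (m := k + r) (by omega)
      rw [← this]
      simp [mul_comm]
    have key' : ((m + r).choose (r + k) : ℤ) * (r + k).factorial = (m + r).descFactorial r * m.descFactorial k := by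
      exact_mod_cast key
    rw [e]
    simp only [smul_eq_mul, mul_one, zero_add, add_comm r k] at key' ⊢
    push_cast
    linear_combination ((-1) ^ (m - k) * ((k + r).choose r : ℤ)) * key'
  · intro k hk
    have : k < r := by simpa using hk
    simp [Nat.choose_eq_zero_of_lt this]

lemma alt_succ (t : ℕ → ℤ) (n : ℕ) :
    ∑ k ∈ Finset.range (n + 1 + 1), (-1) ^ (n + 1 - k) * t k =
      t (n + 1) - ∑ k ∈ Finset.range (n + 1), (-1) ^ (n - k) * t k := by
  rw [Finset.sum_range_succ, sub_eq_add_neg, ← Finset.sum_neg_distrib, add_comm]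
  congr 1
  · simp
  · refine Finset.sum_congr rfl fun k hk => ?_
    have hk' : k ≤ n := by simpa [Nat.lt_succ_iff] using hk
    rw [show n + 1 - k = (n - k) + 1 by omega, pow_succ]
    ring

lemma alt_bound (t : ℕ → ℤ) (h0 : 0 ≤ t 0) (n : ℕ) (ht : ∀ k < n, t k ≤ t (k + 1)) :
    0 ≤ ∑ k ∈ Finset.range (n + 1), (-1) ^ (n - k) * t k ∧
      ∑ k ∈ Finset.range (n + 1), (-1) ^ (n - k) * t k ≤ t n := by
  induction n with
  | zero => simpa using h0
  | succ n ih =>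
    have ih := ih (fun k hk => ht k (by omega))
    have hn := ht n (by omega)
    rw [alt_succ]
    constructor <;> linarith [ih.1, ih.2]

lemma cc_ge (r m : ℕ) (hr : 0 < r) : ((m + 1).factorial : ℤ) ≤ cc r (m + 1) := by
  obtain ⟨s, rfl⟩ : ∃ s, r = s + 1 := ⟨r - 1, by omega⟩
  unfold cc
  set t : ℕ → ℤ := fun k => (((m + 1).descFactorial k * (k + (s + 1)).choose (s + 1) : ℕ) : ℤ) with ht
  have hb := (alt_bound t (by positivity) m ?_).2
  · rw [alt_succ t m]
    have h1 : t (m + 1) = (m + 1).factorial * ((m + 1 + (s + 1)).choose (s + 1) : ℕ) := by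
      simp only [ht, Nat.descFactorial_self]; push_cast; ring
    have h2 : t m = (m + 1).factorial * ((m + (s + 1)).choose (s + 1) : ℕ) := by
      have : (m + 1).descFactorial m = (m + 1).factorial := by
        have h := Nat.descFactorial_succ (m + 1) m
        rw [Nat.descFactorial_self] at h
        simpa using h.symm
      simp [ht, this]
    have h3 : (m + 1 + (s + 1)).choose (s + 1) = (m + (s + 1)).choose s + (m + (s + 1)).choose (s + 1) := by
      rw [show m + 1 + (s + 1) = (m + (s + 1)) + 1 by ring, Nat.choose_succ_succ]
    have h4 : 0 < (m + (s + 1)).choose s := Nat.choose_pos (by omega)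
    have h5 : (1 : ℤ) ≤ ((m + (s + 1)).choose s : ℕ) := by exact_mod_cast h4
    have h6 : (0 : ℤ) ≤ ((m + 1).factorial : ℤ) := by positivity
    rw [h1, h3]
    rw [h2] at hb
    push_cast at *
    nlinarith
  · intro k hk
    simp only [ht]
    norm_cast
    rw [Nat.descFactorial_succ]
    refine Nat.mul_le_mul (Nat.le_mul_of_pos_left _ (by omega)) (Nat.choose_le_choose _ (by omega))

lemma cc_mod (r m : ℕ) : ∃ z : ℤ, cc r m = (-1) ^ m + m * z := by
  unfold cc
  rw [Finset.sum_range_succ']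
  have : (m : ℤ) ∣ ∑ k ∈ Finset.range m, (-1) ^ (m - (k + 1)) *
      ((m.descFactorial (k + 1) * (k + 1 + r).choose r : ℕ) : ℤ) := by
    refine Finset.dvd_sum fun k hk => Dvd.dvd.mul_left ?_ _
    norm_cast
    refine Dvd.dvd.mul_right ?_ _
    rcases m with _ | m
    · simp at hk
    · rw [Nat.succ_descFactorial_succ]; exact dvd_mul_right _ _
  obtain ⟨z, hz⟩ := this
  exact ⟨z, by rw [hz]; simp [add_comm]⟩

theorem Cr_prime_divisors_infinite (r : ℕ) (hr : 0 < r) :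
    {p : ℕ | p.Prime ∧ ∃ n : ℕ, r ≤ n ∧ p ∣ Cr r n}.Infinite := by
  intro hfin
  set S := hfin.toFinset with hS
  set m := 2 * ∏ p ∈ S, p with hm
  have hpos : 0 < ∏ p ∈ S, p := by
    refine Finset.prod_pos fun p hp => ?_
    have : p ∈ {p : ℕ | p.Prime ∧ ∃ n : ℕ, r ≤ n ∧ p ∣ Cr r n} := by simpa [hS] using hp
    exact this.1.pos
  have hge : (2 : ℤ) ≤ cc r m := by
    obtain ⟨k, hk⟩ : ∃ k, m = k + 1 := ⟨m - 1, by omega⟩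
    have := cc_ge r k hr
    rw [← hk] at this
    have h2 : m ≤ m.factorial := Nat.self_le_factorial m
    have h3 : (m : ℤ) ≤ m.factorial := by exact_mod_cast h2
    omega
  have hC : (Cr r (m + r) : ℤ) = cc r m := by
    have h := rDer_cc r m
    have hd : 0 < (m + r).descFactorial r := Nat.descFactorial_pos.mpr (by omega)
    unfold Cr
    push_cast
    rw [h, Int.mul_ediv_cancel_left _ (by positivity)]
  have hne : Cr r (m + r) ≠ 1 := by
    intro h; rw [h] at hC; push_cast at hC; omega
  obtain ⟨q, hq, hqd⟩ := Nat.exists_prime_and_dvd hne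
  have hqS : q ∈ S := by
    rw [hS, Set.Finite.mem_toFinset]
    exact ⟨hq, m + r, by omega, hqd⟩
  have hqm : q ∣ m := Dvd.dvd.mul_left (Finset.dvd_prod_of_mem _ hqS) _
  obtain ⟨z, hz⟩ := cc_mod r m
  have h1 : (q : ℤ) ∣ cc r m := by rw [← hC]; exact_mod_cast hqd
  have h2 : (q : ℤ) ∣ m * z := Dvd.dvd.mul_right (by exact_mod_cast hqm) _
  have h3 : (q : ℤ) ∣ (-1) ^ m := by
    have := dvd_sub h1 h2
    rwa [hz, add_sub_cancel_right] at this
  have h4 : (q : ℤ) ∣ 1 := by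
    rwa [Even.neg_one_pow ⟨∏ p ∈ S, p, by omega⟩] at h3
  have := Int.natCast_dvd_natCast.mp (by simpa using h4 : (q : ℤ) ∣ ((1 : ℕ) : ℤ))
  exact hq.one_lt.ne' (Nat.dvd_one.mp this)
end
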